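/- arXiv:2402.08478 — 6 statements merged into one kernel-verified Lean document; each statement's English description precedes it below -/
import Mathlib

section
/- Let φ ∈ Υ̃(]a,b[) and P ∈ ℝ^K with all p_k > 0 satisfy the representability condition with probability measure ζ̃; write φ̃ := M_P·φ and Λ(z) := log ∫_ℝ e^{z·y} dζ̃(y). Fix t** ∈ ]t_-^{sc}, t_+^{sc}[, set τ := φ̃'(t**), and let U be the probability measure dU(v) := e^{τ·v − Λ(τ)} dζ̃(v). Then Λ(τ) < ∞ and for every t ∈ ℝ: sup_{z∈ℝ}( z·t − log ∫_ℝ e^{z·y} dU(y) ) = φ̃(t) − φ̃(t**) − φ̃'(t**)·(t − t**). -/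
open MeasureTheory ProbabilityTheory Filter Set
open scoped ENNReal NNReal Topology Pointwise

noncomputable section

namespace BareSim

/-- Extended logarithm on `ℝ≥0∞`, with values in `EReal`. -/
def elog (x : ℝ≥0∞) : EReal :=
  if x = 0 then ⊥ else if x = ⊤ then ⊤ else ((Real.log x.toReal : ℝ) : EReal)

/-- Extended exponential, mapping `EReal` to `ℝ≥0∞`. -/
def eexp (x : EReal) : ℝ≥0∞ :=
  if x = ⊤ then ⊤ else if x = ⊥ then 0 else ENNReal.ofReal (Real.exp x.toReal)

/-- Moment generating function `z ↦ ∫ e^{z·y} dζ(y)` of a measure on `ℝ`,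
as a lower integral with values in `[0,∞]`. -/
def MGFe (ζ : Measure ℝ) (z : ℝ) : ℝ≥0∞ := ∫⁻ y, ENNReal.ofReal (Real.exp (z * y)) ∂ζ

/-- Exponentially tilted measure `dŨ(v) := e^{τ·v}·(∫ e^{τ·y} dζ(y))⁻¹ dζ(v)`. -/
def expTilt (ζ : Measure ℝ) (τ : ℝ) : Measure ℝ :=
  ζ.withDensity fun v => ENNReal.ofReal (Real.exp (τ * v)) * (MGFe ζ τ)⁻¹

/-- The class `Υ̃(]a,b[)` of divergence generators: lower semicontinuous convex
functions `φ : ℝ → [0,∞]` with `φ(1) = 0`, strictly convex at `t = 1` (i.e. not affine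
on any open interval containing `1`), whose effective domain has interior `]a,b[`. -/
structure DivGen (a b : ℝ) (φ : ℝ → ℝ≥0∞) : Prop where
  lsc : LowerSemicontinuous φ
  convex : ∀ x y t : ℝ, 0 ≤ t → t ≤ 1 →
    φ (t * x + (1 - t) * y) ≤ ENNReal.ofReal t * φ x + ENNReal.ofReal (1 - t) * φ y
  at_one : φ 1 = 0
  domInterior : interior {t : ℝ | φ t < ⊤} = Set.Ioo a b
  strictly_convex_at_one : ∀ ε > 0,
    ¬ ∃ c d : ℝ, ∀ t ∈ Set.Ioo (1 - ε) (1 + ε), φ t = ENNReal.ofReal (c * t + d)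

/-- The representability condition: `φt` is the Legendre–Fenchel transform of the
cumulant generating function of a Borel probability measure `ζ` on `ℝ` whose moment
generating function is finite on an open interval containing `0`. -/
structure Represent (φt : ℝ → ℝ≥0∞) (ζ : Measure ℝ) : Prop where
  prob : IsProbabilityMeasure ζ
  mgf_fin : ∃ ε > 0, ∀ z : ℝ, |z| < ε → MGFe ζ z < ⊤
  rep : ∀ t : ℝ, (φt t : EReal) = ⨆ z : ℝ, (((z * t : ℝ) : EReal) - elog (MGFe ζ z))

/-- Block sizes: `n_k := ⌊n·pt_k⌋` for `k = 1,…,K−1` and `n_K := n − Σ_{k<K} n_k`. -/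
def bSize (K : ℕ) (pt : Fin K → ℝ) (n : ℕ) (k : Fin K) : ℕ :=
  if (k : ℕ) < K - 1 then ⌊(n : ℝ) * pt k⌋₊
  else n - ∑ j ∈ Finset.univ.filter (fun j : Fin K => (j : ℕ) < K - 1), ⌊(n : ℝ) * pt j⌋₊

/-- Starting index of the `k`-th block. -/
def bStart (K : ℕ) (pt : Fin K → ℝ) (n : ℕ) (k : Fin K) : ℕ :=
  ∑ j ∈ Finset.univ.filter (fun j : Fin K => (j : ℕ) < (k : ℕ)), bSize K pt n j

/-- The `k`-th consecutive block `I_k^{(n)}` of indices in `{0,…,n−1}`. -/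
def bBlock (K : ℕ) (pt : Fin K → ℝ) (n : ℕ) (k : Fin K) : Finset ℕ :=
  Finset.Ico (bStart K pt n k) (bStart K pt n k + bSize K pt n k)

/-- The block-average vector `ξ_n := ( (1/n)·Σ_{i∈I_k^{(n)}} W_i )_{k=1,…,K}`. -/
def xiAvg {X : Type*} (K : ℕ) (pt : Fin K → ℝ) (W : ℕ → X → ℝ) (n : ℕ) (x : X) :
    Fin K → ℝ :=
  fun k => (1 / (n : ℝ)) * ∑ i ∈ bBlock K pt n k, W i x

/-- The normalized block vector `ξ_n^{w}`; on the event `Σ_{j<n} W_j = 0` it takes a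
junk value (all coordinates `−1`), which lies outside of the probability simplex. -/
def xiNorm {X : Type*} (K : ℕ) (pt : Fin K → ℝ) (W : ℕ → X → ℝ) (n : ℕ) (x : X) :
    Fin K → ℝ :=
  if (∑ j ∈ Finset.range n, W j x) ≠ 0 then
    fun k => (∑ i ∈ bBlock K pt n k, W i x) / (∑ j ∈ Finset.range n, W j x)
  else fun _ => -1

/-- The Csiszár–Ali–Silvey–Morimoto φ-divergence `D_φ(Q,P) = Σ_k p_k·φ(q_k/p_k)`
(all components of `p` strictly positive). -/
def Dphi (K : ℕ) (φ : ℝ → ℝ≥0∞) (p Q : Fin K → ℝ) : ℝ≥0∞ :=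
  ∑ k, ENNReal.ofReal (p k) * φ (Q k / p k)

/-- The scaled Bregman distance
`D^{SBD}_{φ,P}(Q,Q**) = Σ_k p_k·[φ(q_k/p_k) − φ(q**_k/p_k) − φ'(q**_k/p_k)·(q_k/p_k − q**_k/p_k)]`,
where `φd` is the derivative of (the real-valued version of) `φ`. -/
def DSBD (K : ℕ) (φ : ℝ → ℝ≥0∞) (φd : ℝ → ℝ) (p Qs Q : Fin K → ℝ) : EReal :=
  ∑ k, ((p k : ℝ) : EReal) *
    ((φ (Q k / p k) : EReal) - (φ (Qs k / p k) : EReal)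
      - ((φd (Qs k / p k) * (Q k / p k - Qs k / p k) : ℝ) : EReal))

theorem MGFe_ne_zero (ζ : Measure ℝ) [IsProbabilityMeasure ζ] (z : ℝ) : MGFe ζ z ≠ 0 := by
  rw [MGFe, ← pos_iff_ne_zero, lintegral_pos_iff_support (by fun_prop)]
  have : Function.support (fun y : ℝ => ENNReal.ofReal (Real.exp (z * y))) = Set.univ := by
    ext y
    simp [Real.exp_pos]
  simp [this]

theorem elog_of_ne {x : ℝ≥0∞} (h0 : x ≠ 0) (ht : x ≠ ⊤) :
    elog x = ((Real.log x.toReal : ℝ) : EReal) := by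
  simp [elog, h0, ht]

theorem elog_top : elog ⊤ = ⊤ := by simp [elog]

/-- Lower semicontinuity of the moment generating function, along sequences. -/
theorem MGFe_le_of_tendsto (ζ : Measure ℝ) {z : ℕ → ℝ} {τ : ℝ} (hz : Tendsto z atTop (𝓝 τ))
    {u : ℕ → ℝ≥0∞} {c : ℝ≥0∞} (hu : Tendsto u atTop (𝓝 c)) (h : ∀ n, MGFe ζ (z n) ≤ u n) :
    MGFe ζ τ ≤ c := by
  have hlim : ∀ y : ℝ, liminf (fun n => ENNReal.ofReal (Real.exp (z n * y))) atTop
      = ENNReal.ofReal (Real.exp (τ * y)) := fun y =>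
    (ENNReal.tendsto_ofReal
      ((Real.continuous_exp.tendsto _).comp (hz.mul_const y))).liminf_eq
  calc MGFe ζ τ = ∫⁻ y, liminf (fun n => ENNReal.ofReal (Real.exp (z n * y))) atTop ∂ζ := by
        simp only [hlim, MGFe]
    _ ≤ liminf (fun n => MGFe ζ (z n)) atTop :=
        lintegral_liminf_le (fun n => by fun_prop)
    _ ≤ liminf u atTop := liminf_le_liminf (Eventually.of_forall h)
    _ = c := hu.liminf_eq

/-- Approximate subgradients of a function at a point of differentiability converge
to the derivative. -/
theorem tendsto_of_approx_subgradient {F : ℝ → ℝ} {x τ : ℝ} (hF : HasDerivAt F τ x)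
    {z ε : ℕ → ℝ} (hε : Tendsto ε atTop (𝓝 0))
    (h : ∀ᶠ s in 𝓝 x, ∀ n, z n * (s - x) ≤ F s - F x + ε n) :
    Tendsto z atTop (𝓝 τ) := by
  have hslope := hasDerivAt_iff_tendsto_slope.1 hF
  refine tendsto_order.2 ⟨fun c hc => ?_, fun c hc => ?_⟩
  · have hs : ∀ᶠ s in 𝓝[<] x, c < slope F x s ∧ (∀ n, z n * (s - x) ≤ F s - F x + ε n) ∧ s < x :=
      ((hslope.mono_left (nhdsWithin_mono _ fun s hs => ne_of_lt hs)).eventually_const_lt hc).and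
        ((h.filter_mono nhdsWithin_le_nhds).and self_mem_nhdsWithin)
    obtain ⟨s, hcs, hn, hsx⟩ := hs.exists
    rw [slope_def_field, lt_div_iff_of_neg (by linarith)] at hcs
    filter_upwards [hε.eventually_lt_const (show 0 < c * (s - x) - (F s - F x) by linarith)]
      with n hεn
    nlinarith [hn n]
  · have hs : ∀ᶠ s in 𝓝[>] x, slope F x s < c ∧ (∀ n, z n * (s - x) ≤ F s - F x + ε n) ∧ x < s :=
      ((hslope.mono_left (nhdsWithin_mono _ fun s hs => ne_of_gt hs)).eventually_lt_const hc).and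
        ((h.filter_mono nhdsWithin_le_nhds).and self_mem_nhdsWithin)
    obtain ⟨s, hcs, hn, hsx⟩ := hs.exists
    rw [slope_def_field, div_lt_iff₀ (by linarith)] at hcs
    filter_upwards [hε.eventually_lt_const (show 0 < c * (s - x) - (F s - F x) by linarith)]
      with n hεn
    nlinarith [hn n]

/-- The Fenchel–Young inequality for a representable function. -/
theorem Represent.young {f : ℝ → ℝ≥0∞} {ζ : Measure ℝ} (h : Represent f ζ) {z s : ℝ}
    (hM : MGFe ζ z ≠ ⊤) (hs : f s ≠ ⊤) :
    z * s - Real.log (MGFe ζ z).toReal ≤ (f s).toReal := by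
  have := h.prob
  have hle : ((z * s : ℝ) : EReal) - elog (MGFe ζ z) ≤ (f s : EReal) := by
    rw [h.rep s]
    exact le_iSup (fun z : ℝ => ((z * s : ℝ) : EReal) - elog (MGFe ζ z)) z
  rw [elog_of_ne (MGFe_ne_zero ζ z) hM, ← EReal.coe_ennreal_toReal hs] at hle
  exact_mod_cast hle

theorem Represent.exists_approx_maximizer {f : ℝ → ℝ≥0∞} {ζ : Measure ℝ} (h : Represent f ζ)
    {x : ℝ} (hx : f x ≠ ⊤) {ε : ℝ} (hε : 0 < ε) :
    ∃ z : ℝ, MGFe ζ z ≠ ⊤ ∧ Real.log (MGFe ζ z).toReal ≤ z * x - (f x).toReal + ε := by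
  have := h.prob
  have hlt : (((f x).toReal - ε : ℝ) : EReal)
      < ⨆ z : ℝ, (((z * x : ℝ) : EReal) - elog (MGFe ζ z)) := by
    rw [← h.rep x, ← EReal.coe_ennreal_toReal hx]
    exact_mod_cast sub_lt_self _ hε
  obtain ⟨z, hz⟩ := lt_iSup_iff.1 hlt
  have hM : MGFe ζ z ≠ ⊤ := by
    intro hM
    simp [hM, elog_top] at hz
  refine ⟨z, hM, ?_⟩
  rw [elog_of_ne (MGFe_ne_zero ζ z) hM] at hz
  have hz' : (f x).toReal - ε < z * x - Real.log (MGFe ζ z).toReal := by exact_mod_cast hz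
  linarith

/-- At a point `x` of differentiability, the moment generating function is finite at the
derivative of the representable function. -/
theorem Represent.MGFe_deriv_le {f : ℝ → ℝ≥0∞} {ζ : Measure ℝ} (h : Represent f ζ) {x τ : ℝ}
    (hfin : ∀ᶠ s in 𝓝 x, f s ≠ ⊤) (hF : HasDerivAt (fun s => (f s).toReal) τ x) :
    MGFe ζ τ ≤ ENNReal.ofReal (Real.exp (τ * x - (f x).toReal)) := by
  have := h.prob
  have hx : f x ≠ ⊤ := hfin.self_of_nhds
  have hε : Tendsto (fun n : ℕ => 1 / ((n : ℝ) + 1)) atTop (𝓝 0) :=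
    tendsto_one_div_add_atTop_nhds_zero_nat
  choose z hM hz using fun n : ℕ =>
    h.exists_approx_maximizer hx (Nat.one_div_pos_of_nat (α := ℝ) (n := n))
  have hzτ : Tendsto z atTop (𝓝 τ) := by
    refine tendsto_of_approx_subgradient hF hε (hfin.mono fun s hs n => ?_)
    have h1 := h.young (hM n) hs
    have h2 := hz n
    linarith
  refine MGFe_le_of_tendsto ζ hzτ
    (u := fun n => ENNReal.ofReal (Real.exp (z n * x - (f x).toReal + 1 / ((n : ℝ) + 1)))) ?_ ?_
  · refine ENNReal.tendsto_ofReal ((Real.continuous_exp.tendsto _).comp ?_)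
    simpa using ((hzτ.mul_const x).sub_const (f x).toReal).add hε
  · intro n
    rw [← ENNReal.ofReal_toReal (hM n)]
    refine ENNReal.ofReal_le_ofReal ?_
    rw [← Real.log_le_iff_le_exp (ENNReal.toReal_pos (MGFe_ne_zero ζ _) (hM n))]
    exact hz n

theorem Represent.log_MGFe_deriv {f : ℝ → ℝ≥0∞} {ζ : Measure ℝ} (h : Represent f ζ) {x τ : ℝ}
    (hfin : ∀ᶠ s in 𝓝 x, f s ≠ ⊤) (hF : HasDerivAt (fun s => (f s).toReal) τ x) :
    Real.log (MGFe ζ τ).toReal = τ * x - (f x).toReal := by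
  have := h.prob
  have hle := h.MGFe_deriv_le hfin hF
  have hM : MGFe ζ τ ≠ ⊤ := ne_top_of_le_ne_top ENNReal.ofReal_ne_top hle
  refine le_antisymm ?_ (by linarith [h.young hM hfin.self_of_nhds])
  rw [Real.log_le_iff_le_exp (ENNReal.toReal_pos (MGFe_ne_zero ζ _) hM)]
  exact ENNReal.toReal_le_of_le_ofReal (Real.exp_pos _).le hle

theorem MGFe_expTilt (ζ : Measure ℝ) (τ z : ℝ) :
    MGFe (expTilt ζ τ) z = MGFe ζ (z + τ) * (MGFe ζ τ)⁻¹ := by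
  rw [expTilt]
  generalize (MGFe ζ τ)⁻¹ = c
  rw [MGFe, lintegral_withDensity_eq_lintegral_mul _ (by fun_prop) (by fun_prop), MGFe,
    ← lintegral_mul_const _ (by fun_prop)]
  refine lintegral_congr fun y => ?_
  rw [Pi.mul_apply, mul_right_comm, ← ENNReal.ofReal_mul (Real.exp_pos _).le, ← Real.exp_add,
    add_mul, add_comm (τ * y)]

theorem elog_mul_inv {x c : ℝ≥0∞} (hx : x ≠ 0) (hc : c ≠ 0) (hct : c ≠ ⊤) :
    elog (x * c⁻¹) = elog x - ((Real.log c.toReal : ℝ) : EReal) := by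
  rcases eq_or_ne x ⊤ with rfl | hxt
  · rw [ENNReal.top_mul (ENNReal.inv_ne_zero.2 hct), elog_top, EReal.top_sub_coe]
  · rw [elog_of_ne (mul_ne_zero hx (ENNReal.inv_ne_zero.2 hct))
      (ENNReal.mul_ne_top hxt (ENNReal.inv_ne_top.2 hc)), elog_of_ne hx hxt, ENNReal.toReal_mul,
      ENNReal.toReal_inv, Real.log_mul, Real.log_inv]
    · norm_cast
    · exact (ENNReal.toReal_pos hx hxt).ne'
    · exact (inv_pos.2 (ENNReal.toReal_pos hc hct)).ne'

theorem EReal_iSup_add_coe {ι : Sort*} (g : ι → EReal) (c : ℝ) :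
    (⨆ i, (g i + (c : EReal))) = (⨆ i, g i) + (c : EReal) := by
  refine le_antisymm (iSup_le fun i => add_le_add_left (le_iSup g i) _) ?_
  rw [← EReal.le_sub_iff_add_le (by simp) (by simp)]
  refine iSup_le fun i => ?_
  rw [EReal.le_sub_iff_add_le (by simp) (by simp)]
  exact le_iSup (fun i => g i + (c : EReal)) i

/-- Exponential tilting adds an affine function to the Legendre–Fenchel transform of the
cumulant generating function. -/
theorem Represent.iSup_expTilt {f : ℝ → ℝ≥0∞} {ζ : Measure ℝ} (h : Represent f ζ) {τ : ℝ}
    (hM : MGFe ζ τ ≠ ⊤) (t : ℝ) :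
    (⨆ z : ℝ, (((z * t : ℝ) : EReal) - elog (MGFe (expTilt ζ τ) z)))
      = (f t : EReal) + ((Real.log (MGFe ζ τ).toReal - τ * t : ℝ) : EReal) := by
  have := h.prob
  have key : ∀ z : ℝ, ((z * t : ℝ) : EReal) - elog (MGFe (expTilt ζ τ) z)
      = (((z + τ) * t : ℝ) : EReal) - elog (MGFe ζ (z + τ))
        + ((Real.log (MGFe ζ τ).toReal - τ * t : ℝ) : EReal) := by
    intro z
    rw [MGFe_expTilt, elog_mul_inv (MGFe_ne_zero ζ _) (MGFe_ne_zero ζ _) hM]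
    rcases eq_or_ne (MGFe ζ (z + τ)) ⊤ with hT | hT
    · simp [hT, elog_top]
    · rw [elog_of_ne (MGFe_ne_zero ζ _) hT]
      norm_cast
      ring
  simp_rw [key]
  rw [EReal_iSup_add_coe, h.rep t]
  congr 1
  exact (Equiv.addRight τ).surjective.iSup_comp
    (fun w : ℝ => ((w * t : ℝ) : EReal) - elog (MGFe ζ w))

/-- representability of the Bregman remainder via exponential tilting:
if `φ̃ := M_P·φ` is representable through `ζ̃` and `τ := φ̃'(t**)` for `t**` in the
strict-convexity interval, then `Λ(τ) < ∞` and for every `t ∈ ℝ`,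
`sup_z ( z·t − log ∫ e^{z·y} dU(y) ) = φ̃(t) − φ̃(t**) − φ̃'(t**)·(t − t**)`,
where `U` is the exponentially tilted measure. -/
theorem statement1
    (K : ℕ) (a b : ℝ) (ha : a < 1) (hb : 1 < b)
    (φ : ℝ → ℝ≥0∞) (hφ : DivGen a b φ)
    (p : Fin K → ℝ) (hp : ∀ k, 0 < p k)
    (Mp : ℝ) (hMp : Mp = ∑ k, p k)
    (ζ : Measure ℝ) (hrep : Represent (fun t => ENNReal.ofReal Mp * φ t) ζ)
    (φd : ℝ → ℝ) (hφd : ∀ t ∈ Set.Ioo a b, HasDerivAt (fun s => (φ s).toReal) (φd t) t)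
    (tm tsc : ℝ) (htm : 1 ∈ Set.Ioo tm tsc) (hsub : Set.Ioo tm tsc ⊆ Set.Ioo a b)
    (hsc : StrictConvexOn ℝ (Set.Ioo tm tsc) (fun t => (φ t).toReal))
    (tstar : ℝ) (htstar : tstar ∈ Set.Ioo tm tsc)
    (τ : ℝ) (hτ : τ = Mp * φd tstar) :
    elog (MGFe ζ τ) < (⊤ : EReal) ∧
      ∀ t : ℝ,
        (⨆ z : ℝ, (((z * t : ℝ) : EReal) - elog (MGFe (expTilt ζ τ) z)))
          = ((ENNReal.ofReal Mp * φ t : ℝ≥0∞) : EReal)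
              - ((ENNReal.ofReal Mp * φ tstar : ℝ≥0∞) : EReal)
              - ((Mp * φd tstar * (t - tstar) : ℝ) : EReal) := by
  have hfin : ∀ᶠ s in 𝓝 tstar, ENNReal.ofReal Mp * φ s ≠ ⊤ := by
    filter_upwards [isOpen_Ioo.mem_nhds (hsub htstar)] with s hs
    rw [← hφ.domInterior] at hs
    exact ENNReal.mul_ne_top ENNReal.ofReal_ne_top (interior_subset hs).ne
  have hMp0 : 0 ≤ Mp := hMp ▸ Finset.sum_nonneg fun k _ => (hp k).le
  have hF : HasDerivAt (fun s => (ENNReal.ofReal Mp * φ s).toReal) τ tstar := by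
    simpa only [ENNReal.toReal_mul, ENNReal.toReal_ofReal hMp0, hτ] using
      (hφd tstar (hsub htstar)).const_mul Mp
  have := hrep.prob
  have hM : MGFe ζ τ ≠ ⊤ :=
    ne_top_of_le_ne_top ENNReal.ofReal_ne_top (hrep.MGFe_deriv_le hfin hF)
  refine ⟨?_, fun t => ?_⟩
  · rw [elog_of_ne (MGFe_ne_zero ζ τ) hM]
    exact EReal.coe_lt_top _
  · rw [hrep.iSup_expTilt hM t, hrep.log_MGFe_deriv hfin hF, ← hτ,
      ← EReal.coe_ennreal_toReal hfin.self_of_nhds, sub_eq_add_neg (_ - _ : EReal),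
      sub_eq_add_neg (_ : EReal), add_assoc, ← EReal.coe_neg, ← EReal.coe_neg, ← EReal.coe_add]
    congr 2
    ring

end BareSim
end
end

section
/- For all parameters α, β, c̃ ∈ (0,∞) with c̃·β < 1, all K ≥ 1, all Q ∈ ℝ^K and all P ∈ ℝ^K with strictly positive components, one has D_{φ_{α,β,c̃}}(Q,P) ≤ Σ_{k=1}^K |q_k − p_k|, with equality if and only if Q = P. -/
open scoped BigOperators

noncomputable section

namespace BareSim

/-- The divergence generator `φ_{α,β,c̃}` of Example `brostu5:ex.2` (value `0` at `t = 1`). -/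
def phiABC (α β c t : ℝ) : ℝ :=
  if t = 1 then 0
  else
    c * α * (Real.sqrt (1 + β ^ 2 * ((1 - t) / α) ^ 2) - 1 +
      Real.log (2 * (Real.sqrt (1 + β ^ 2 * ((1 - t) / α) ^ 2) - 1) /
        (β ^ 2 * ((1 - t) / α) ^ 2)))

theorem phiABC_one (α β c : ℝ) : phiABC α β c 1 = 0 := by
  simp [phiABC]

theorem phiABC_lt_abs {α β c t : ℝ} (hα : 0 < α) (hβ : 0 < β) (hc : 0 < c)
    (hcβ : c * β < 1) (ht : t ≠ 1) : phiABC α β c t < |1 - t| := by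
  have ht' : 0 < |1 - t| := abs_pos.mpr (sub_ne_zero.mpr ht.symm)
  set y : ℝ := β ^ 2 * ((1 - t) / α) ^ 2 with hy
  have hy0 : 0 ≤ y := by positivity
  have hyx : y = (β * |1 - t| / α) ^ 2 := by
    rw [hy, div_pow, div_pow, mul_pow, sq_abs]
    ring
  have hs : Real.sqrt (1 + y) ^ 2 = 1 + y := Real.sq_sqrt (by linarith)
  have hs1 : 1 ≤ Real.sqrt (1 + y) := Real.one_le_sqrt.mpr (by linarith)
  have hx : 0 ≤ β * |1 - t| / α := by positivity
  have hle : Real.sqrt (1 + y) - 1 ≤ β * |1 - t| / α := by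
    nlinarith
  have hlog : Real.log (2 * (Real.sqrt (1 + y) - 1) / y) ≤ 0 := by
    refine Real.log_nonpos (div_nonneg (by linarith) hy0) (div_le_one_of_le₀ ?_ hy0)
    nlinarith [sq_nonneg (Real.sqrt (1 + y) - 1)]
  rw [phiABC, if_neg ht]
  calc c * α * (Real.sqrt (1 + y) - 1 + Real.log (2 * (Real.sqrt (1 + y) - 1) / y))
      ≤ c * α * (β * |1 - t| / α) := by
        gcongr
        linarith
    _ = c * β * |1 - t| := by field_simp
    _ < |1 - t| := mul_lt_of_lt_one_left ht' hcβ

theorem mul_phiABC_lt_abs_sub {α β c p q : ℝ} (hα : 0 < α) (hβ : 0 < β) (hc : 0 < c)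
    (hcβ : c * β < 1) (hp : 0 < p) (hqp : q ≠ p) :
    p * phiABC α β c (q / p) < |q - p| := by
  have hne : q / p ≠ 1 := fun h => hqp ((div_eq_one_iff_eq hp.ne').mp h)
  calc p * phiABC α β c (q / p) < p * |1 - q / p| :=
        mul_lt_mul_of_pos_left (phiABC_lt_abs hα hβ hc hcβ hne) hp
    _ = |q - p| := by
        rw [← abs_of_pos hp, ← abs_mul, abs_of_pos hp, abs_sub_comm q p]
        congr 1
        field_simp

theorem mul_phiABC_self_div (α β c : ℝ) {p : ℝ} (hp : 0 < p) :
    p * phiABC α β c (p / p) = |p - p| := by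
  rw [div_self hp.ne', phiABC_one, mul_zero, sub_self, abs_zero]

/-- for all `α, β, c̃ ∈ (0,∞)` with `c̃·β < 1`, all `K ≥ 1`, all
`Q ∈ ℝ^K` and all `P ∈ ℝ^K` with strictly positive components, one has
`D_{φ_{α,β,c̃}}(Q,P) ≤ Σ_k |q_k − p_k|`, with equality if and only if `Q = P`. -/
theorem statement5 (α β c : ℝ) (hα : 0 < α) (hβ : 0 < β) (hc : 0 < c)
    (hcβ : c * β < 1) (K : ℕ) (hK : 1 ≤ K) (Q P : Fin K → ℝ) (hP : ∀ k, 0 < P k) :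
    (∑ k, P k * phiABC α β c (Q k / P k)) ≤ (∑ k, |Q k - P k|) ∧
      ((∑ k, P k * phiABC α β c (Q k / P k)) = (∑ k, |Q k - P k|) ↔ Q = P) := by
  have hle : ∀ k ∈ Finset.univ, P k * phiABC α β c (Q k / P k) ≤ |Q k - P k| := by
    intro k _
    rcases eq_or_ne (Q k) (P k) with h | h
    · rw [h]
      exact (mul_phiABC_self_div α β c (hP k)).le
    · exact (mul_phiABC_lt_abs_sub hα hβ hc hcβ (hP k) h).le
  refine ⟨Finset.sum_le_sum hle, fun h => ?_, ?_⟩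
  · funext k
    by_contra hk
    exact (mul_phiABC_lt_abs_sub hα hβ hc hcβ (hP k) hk).ne
      ((Finset.sum_eq_sum_iff_of_le hle).mp h k (Finset.mem_univ k))
  · rintro rfl
    exact Finset.sum_congr rfl fun k _ => mul_phiABC_self_div α β c (hP k)

end BareSim
end
end

section
/- For all γ ∈ (1,∞), β ∈ (0,1), c̃ ∈ (0,∞) and all t ∈ ℝ, one has φ_{β,β,c̃/γ}(t) ≤ c̃·φ_γ(t), with equality if and only if t = 1. -/
open scoped BigOperators

noncomputable section

namespace BareSim

/-- The power-divergence generator `φ_γ` for `γ ∈ (1,∞)`: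
`φ_γ(t) = (t^γ − γ·t + γ − 1)/(γ·(γ−1))` for `t > 0` and `φ_γ(t) = 1/γ − t/(γ−1)`
for `t ≤ 0`. -/
def phiGamR (γ t : ℝ) : ℝ :=
  if 0 < t then (t ^ γ - γ * t + γ - 1) / (γ * (γ - 1)) else 1 / γ - t / (γ - 1)

/-- Closed form of the bracket in `phiABC` for `α = β`, in terms of `√(1 + (1 - t)²)`. -/
lemma phiABC_self_eq {β c t : ℝ} (hβ : 0 < β) (ht : t ≠ 1) :
    phiABC β β c t = c * β * (√(1 + (1 - t) ^ 2) - 1 - Real.log ((√(1 + (1 - t) ^ 2) + 1) / 2)) := by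
  have hx : 0 < (1 - t) ^ 2 := by
    have : 1 - t ≠ 0 := sub_ne_zero.mpr ht.symm
    positivity
  have hq : β ^ 2 * ((1 - t) / β) ^ 2 = (1 - t) ^ 2 := by field_simp
  have hs : √(1 + (1 - t) ^ 2) ^ 2 = 1 + (1 - t) ^ 2 := Real.sq_sqrt (by positivity)
  rw [phiABC, if_neg ht, hq, sub_eq_add_neg _ (Real.log _), ← Real.log_inv]
  congr 4
  rw [inv_div, div_eq_div_iff hx.ne' (by positivity)]
  linear_combination 2 * hs

/-- The generator `t log t - t + 1` of the Kullback-Leibler divergence is a lower bound for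
`γ · φ_γ`. -/
lemma mul_log_sub_add_one_le_mul_phiGamR {γ t : ℝ} (hγ : 1 < γ) (ht : 0 < t) :
    t * Real.log t - t + 1 ≤ γ * phiGamR γ t := by
  have hγ1 : 0 < γ - 1 := sub_pos.mpr hγ
  have hpow : t * (1 + (γ - 1) * Real.log t) ≤ t ^ γ := by
    have h : t ^ γ = t * Real.exp ((γ - 1) * Real.log t) := by
      conv_rhs => enter [1]; rw [← Real.exp_log ht]
      rw [← Real.exp_add, Real.rpow_def_of_pos ht]
      ring_nf
    rw [h]
    gcongr
    linarith [Real.add_one_le_exp ((γ - 1) * Real.log t)]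
  have heq : γ * phiGamR γ t = (t ^ γ - γ * t + γ - 1) / (γ - 1) := by
    rw [phiGamR, if_pos ht]
    field_simp
  rw [heq, le_div_iff₀ hγ1]
  linear_combination hpow

lemma sq_div_four_le_mul_log_sub_add_one {t : ℝ} (ht : 0 < t) (ht1 : t ≤ 1) :
    (1 - t) ^ 2 / 4 ≤ t * Real.log t - t + 1 := by
  obtain ⟨r, hr, rfl⟩ : ∃ r : ℝ, 0 < r ∧ t = r ^ 2 :=
    ⟨√t, Real.sqrt_pos.mpr ht, (Real.sq_sqrt ht.le).symm⟩
  have hr1 : r ≤ 1 := by nlinarith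
  have hlog : r - 1 ≤ r * Real.log r := by
    have h := mul_le_mul_of_nonneg_left (Real.one_sub_inv_le_log_of_pos hr) hr.le
    rwa [mul_sub, mul_inv_cancel₀ hr.ne', mul_one] at h
  rw [Real.log_pow]
  push_cast
  have h1 : (1 - r) ^ 2 * (1 + r) ^ 2 ≤ (1 - r) ^ 2 * 4 := by
    gcongr
    nlinarith
  nlinarith [mul_le_mul_of_nonneg_left hlog hr.le]

lemma sq_div_le_mul_log_sub_add_one {t : ℝ} (ht : 1 ≤ t) :
    (1 - t) ^ 2 / (t + 1) ≤ t * Real.log t - t + 1 := by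
  have h := Real.le_log_one_add_of_nonneg (sub_nonneg.mpr ht)
  rw [show t - 1 + 2 = t + 1 by ring, add_sub_cancel, div_le_iff₀ (by linarith)] at h
  rw [div_le_iff₀ (by linarith)]
  nlinarith [mul_le_mul_of_nonneg_left h (by linarith : 0 ≤ t)]

lemma sqrt_sub_log_le_mul_log_sub_add_one {t : ℝ} (ht : 0 < t) :
    √(1 + (1 - t) ^ 2) - 1 - Real.log ((√(1 + (1 - t) ^ 2) + 1) / 2) ≤
      t * Real.log t - t + 1 := by
  set s := √(1 + (1 - t) ^ 2)
  have hs : s ^ 2 = 1 + (1 - t) ^ 2 := Real.sq_sqrt (by positivity)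
  have hs1 : 1 ≤ s := Real.one_le_sqrt.mpr (by nlinarith [sq_nonneg (1 - t)])
  have hlog : 1 - ((s + 1) / 2)⁻¹ ≤ Real.log ((s + 1) / 2) :=
    Real.one_sub_inv_le_log_of_pos (by positivity)
  have hB : s - 1 - (1 - ((s + 1) / 2)⁻¹) = (1 - t) ^ 2 / ((s + 1) ^ 2 / s) := by
    have : (1 - t) ^ 2 = (s - 1) * (s + 1) := by linear_combination -hs
    rw [this]
    have : s ≠ 0 := by positivity
    field_simp
    ring
  have hle : s - 1 - Real.log ((s + 1) / 2) ≤ (1 - t) ^ 2 / ((s + 1) ^ 2 / s) := by linarith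
  refine hle.trans ?_
  rcases le_total t 1 with h | h
  · refine le_trans ?_ (sq_div_four_le_mul_log_sub_add_one ht h)
    gcongr
    rw [le_div_iff₀ (by positivity)]
    nlinarith [sq_nonneg (s - 1)]
  · refine le_trans ?_ (sq_div_le_mul_log_sub_add_one h)
    have hst : t - 1 ≤ s := Real.le_sqrt_of_sq_le (by nlinarith)
    gcongr
    rw [le_div_iff₀ (by positivity)]
    nlinarith

lemma sqrt_sub_log_le_mul_phiGamR {γ : ℝ} (hγ : 1 < γ) (t : ℝ) :
    √(1 + (1 - t) ^ 2) - 1 - Real.log ((√(1 + (1 - t) ^ 2) + 1) / 2) ≤ γ * phiGamR γ t := by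
  rcases lt_or_ge 0 t with ht | ht
  · exact (sqrt_sub_log_le_mul_log_sub_add_one ht).trans (mul_log_sub_add_one_le_mul_phiGamR hγ ht)
  · have hγ1 : 0 < γ - 1 := sub_pos.mpr hγ
    have hs1 : 1 ≤ √(1 + (1 - t) ^ 2) := Real.one_le_sqrt.mpr (by nlinarith [sq_nonneg (1 - t)])
    have hs : √(1 + (1 - t) ^ 2) ≤ 1 + (1 - t) := Real.sqrt_le_iff.mpr ⟨by linarith, by nlinarith⟩
    have hlog : 0 ≤ Real.log ((√(1 + (1 - t) ^ 2) + 1) / 2) := Real.log_nonneg (by linarith)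
    have heq : γ * phiGamR γ t = 1 - t + -t / (γ - 1) := by
      rw [phiGamR, if_neg ht.not_gt]
      field_simp
      ring
    have : 0 ≤ -t / (γ - 1) := div_nonneg (by linarith) hγ1.le
    linarith

lemma sqrt_sub_log_pos {t : ℝ} (ht : t ≠ 1) :
    0 < √(1 + (1 - t) ^ 2) - 1 - Real.log ((√(1 + (1 - t) ^ 2) + 1) / 2) := by
  have hx : 0 < (1 - t) ^ 2 := by
    have : 1 - t ≠ 0 := sub_ne_zero.mpr ht.symm
    positivity
  have hs : 1 < √(1 + (1 - t) ^ 2) := Real.lt_sqrt_of_sq_lt (by linarith)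
  have hlog := Real.log_le_sub_one_of_pos
    (show 0 < (√(1 + (1 - t) ^ 2) + 1) / 2 by positivity)
  linarith

lemma phiABC_self_lt {γ β c t : ℝ} (hγ : 1 < γ) (hβ0 : 0 < β) (hβ1 : β < 1) (hc : 0 < c)
    (ht : t ≠ 1) : phiABC β β (c / γ) t < c * phiGamR γ t := by
  have hγ0 : 0 < γ := one_pos.trans hγ
  have hpos := sqrt_sub_log_pos ht
  have hle := sqrt_sub_log_le_mul_phiGamR hγ t
  rw [phiABC_self_eq hβ0 ht]
  set B := √(1 + (1 - t) ^ 2) - 1 - Real.log ((√(1 + (1 - t) ^ 2) + 1) / 2)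
  calc c / γ * β * B = c / γ * (β * B) := by ring
    _ < c / γ * (γ * phiGamR γ t) :=
        mul_lt_mul_of_pos_left ((mul_lt_of_lt_one_left hpos hβ1).trans_le hle) (by positivity)
    _ = c * phiGamR γ t := by field_simp

/-- bound `brostu5:fo.boundPOWdivmiss`: for all `γ ∈ (1,∞)`,
`β ∈ (0,1)`, `c̃ ∈ (0,∞)` and all `t ∈ ℝ`, one has `φ_{β,β,c̃/γ}(t) ≤ c̃·φ_γ(t)`,
with equality if and only if `t = 1`. -/
theorem statement6 (γ β c : ℝ) (hγ : 1 < γ) (hβ0 : 0 < β) (hβ1 : β < 1) (hc : 0 < c)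
    (t : ℝ) :
    phiABC β β (c / γ) t ≤ c * phiGamR γ t ∧
      (phiABC β β (c / γ) t = c * phiGamR γ t ↔ t = 1) := by
  by_cases ht : t = 1
  · subst ht
    have h : phiABC β β (c / γ) 1 = c * phiGamR γ 1 := by simp [phiABC, phiGamR]
    exact ⟨h.le, by simp [h]⟩
  · have h := phiABC_self_lt hγ hβ0 hβ1 hc ht
    exact ⟨h.le, by simp [h.ne, ht]⟩

end BareSim
end
end

section
/- Let A > 0, P ∈ ℝ^K with all p_k > 0, c̃ > 0, γ ∈ ℝ \ {0,1}, Q** ∈ ℝ^K with all q**_k > 0, and Q ∈ M̃_γ, where M̃_γ := A·𝕊^K_{>0} for γ < 0 and M̃_γ := A·𝕊^K for γ > 0. Then inf_{m≠0} D^{SBD}_{c̃·φ_γ,P}(m·Q, Q**) = (c̃/γ)·[ H_γ(Q**,P) − T_γ(Q,Q**,P)^{γ/(γ−1)} · H_γ(Q,P)^{−1/(γ−1)} ]. -/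
open scoped BigOperators ENNReal Pointwise

noncomputable section

namespace BareSim

/-- The positive part `𝕊^K_{>0}` of the probability simplex. -/
def stdSimplexPos (K : ℕ) : Set (Fin K → ℝ) := {Q | (∀ k, 0 < Q k) ∧ ∑ k, Q k = 1}

/-- The power-divergence generator `φ_γ : ℝ → [0,∞]` for `γ ∈ ℝ \ {0,1}`:
`φ_γ(t) = (t^γ − γ·t + γ − 1)/(γ·(γ−1))` for `t > 0` (with `φ_γ(0) = 1/γ` for `γ > 0`,
using `0^γ := 0`), `φ_γ(t) = 1/γ − t/(γ−1)` for `t ≤ 0` if `γ > 1`, and `+∞`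
otherwise. -/
def phiGamE (γ t : ℝ) : ℝ≥0∞ :=
  if 0 < t then ENNReal.ofReal ((t ^ γ - γ * t + γ - 1) / (γ * (γ - 1)))
  else if 1 < γ then ENNReal.ofReal (1 / γ - t / (γ - 1))
  else if 0 < γ ∧ t = 0 then ENNReal.ofReal (1 / γ)
  else ⊤

/-- The derivative `φ_γ'(t) = (t^{γ−1} − 1)/(γ−1)` of `φ_γ` (for `t > 0`). -/
def dphiGamR (γ t : ℝ) : ℝ := (t ^ (γ - 1) - 1) / (γ - 1)

/-- The scaled Bregman distance `D^{SBD}_{c̃·φ_γ,P}(Q,Q**)` with generator `c̃·φ_γ`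
and scaling vector `P` (components of `P` and `Q**` strictly positive). -/
def DSBDg (K : ℕ) (γ c : ℝ) (p Qs Q : Fin K → ℝ) : EReal :=
  ((c : ℝ) : EReal) * ∑ k, ((p k : ℝ) : EReal) *
    ((phiGamE γ (Q k / p k) : EReal) - (phiGamE γ (Qs k / p k) : EReal)
      - ((dphiGamR γ (Qs k / p k) * (Q k / p k - Qs k / p k) : ℝ) : EReal))

/-- The modified `γ`-order Hellinger integral `H_γ(Q,P) = Σ_k q_k^γ·p_k^{1−γ}`. -/
def Hgam (K : ℕ) (γ : ℝ) (Q p : Fin K → ℝ) : ℝ := ∑ k, Q k ^ γ * p k ^ (1 - γ)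

/-- The `γ`-order triple power sum `T_γ(Q,Q**,P) = Σ_k q_k·(q**_k)^{γ−1}·p_k^{1−γ}`. -/
def Tgam (K : ℕ) (γ : ℝ) (Q Qs p : Fin K → ℝ) : ℝ :=
  ∑ k, Q k * Qs k ^ (γ - 1) * p k ^ (1 - γ)

/-- Bernoulli's inequality for a negative exponent. -/
lemma one_add_mul_sub_one_le_rpow_of_neg {γ t : ℝ} (hγ : γ < 0) (ht : 0 < t) :
    1 + γ * (t - 1) ≤ t ^ γ := by
  have h := one_add_mul_self_le_rpow_one_add (s := t⁻¹ - 1) (p := 1 - γ)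
    (by linarith [inv_pos.2 ht]) (by linarith)
  rw [add_sub_cancel, Real.inv_rpow ht.le, ← Real.rpow_neg ht.le, neg_sub] at h
  have h' := mul_le_mul_of_nonneg_left h ht.le
  rw [Real.rpow_sub_one ht.ne', mul_div_cancel₀ _ ht.ne'] at h'
  have e : t * (1 + (1 - γ) * (t⁻¹ - 1)) = 1 + γ * (t - 1) := by
    field_simp
    ring
  linarith

lemma powerDivergence_nonneg {γ t : ℝ} (hγ0 : γ ≠ 0) (hγ1 : γ ≠ 1) (ht : 0 < t) :
    0 ≤ (t ^ γ - γ * t + γ - 1) / (γ * (γ - 1)) := by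
  rcases lt_or_gt_of_ne hγ0 with h0 | h0
  · have h := one_add_mul_sub_one_le_rpow_of_neg h0 ht
    exact div_nonneg (by linarith) (mul_nonneg_of_nonpos_of_nonpos h0.le (by linarith))
  rcases lt_or_gt_of_ne hγ1 with h1 | h1
  · have h := rpow_one_add_le_one_add_mul_self (s := t - 1) (by linarith) h0.le h1.le
    rw [add_sub_cancel] at h
    exact div_nonneg_of_nonpos (by linarith)
      (mul_nonpos_of_nonneg_of_nonpos h0.le (by linarith))
  · have h := one_add_mul_self_le_rpow_one_add (s := t - 1) (by linarith) h1.le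
    rw [add_sub_cancel] at h
    exact div_nonneg (by linarith) (mul_nonneg h0.le (by linarith))

/-- The two-point form of `powerDivergence_nonneg`. -/
lemma rpow_tangent_nonneg {γ m a : ℝ} (hγ0 : γ ≠ 0) (hγ1 : γ ≠ 1) (hm : 0 < m) (ha : 0 < a) :
    0 ≤ (m ^ γ - γ * m * a ^ (γ - 1) + (γ - 1) * a ^ γ) / (γ * (γ - 1)) := by
  have h := mul_nonneg (Real.rpow_pos_of_pos ha γ).le
    (powerDivergence_nonneg hγ0 hγ1 (div_pos hm ha))
  have e : (m ^ γ - γ * m * a ^ (γ - 1) + (γ - 1) * a ^ γ) / (γ * (γ - 1))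
      = a ^ γ * (((m / a) ^ γ - γ * (m / a) + γ - 1) / (γ * (γ - 1))) := by
    have := (Real.rpow_pos_of_pos ha γ).ne'
    rw [Real.div_rpow hm.le ha.le, Real.rpow_sub_one ha.ne', mul_div_assoc']
    field_simp
    ring
  rwa [e]

lemma phiGamE_of_pos {γ t : ℝ} (hγ0 : γ ≠ 0) (hγ1 : γ ≠ 1) (ht : 0 < t) :
    (phiGamE γ t : EReal) = (((t ^ γ - γ * t + γ - 1) / (γ * (γ - 1)) : ℝ) : EReal) := by
  rw [phiGamE, if_pos ht, EReal.coe_ennreal_ofReal,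
    max_eq_left (powerDivergence_nonneg hγ0 hγ1 ht)]

lemma phiGamE_of_nonpos {γ t : ℝ} (ht : t ≤ 0) (hγ : 1 < γ) :
    (phiGamE γ t : EReal) = (((0 - γ * t + γ - 1) / (γ * (γ - 1)) : ℝ) : EReal) := by
  have hγ1 : 0 < γ - 1 := by linarith
  have hγ0 : 0 < γ := by linarith
  have e : 1 / γ - t / (γ - 1) = (0 - γ * t + γ - 1) / (γ * (γ - 1)) := by
    field_simp
    ring
  have h : 0 ≤ 1 / γ - t / (γ - 1) :=
    sub_nonneg.2 ((div_nonpos_of_nonpos_of_nonneg ht hγ1.le).trans (by positivity))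
  rw [phiGamE, if_neg ht.not_gt, if_pos hγ, EReal.coe_ennreal_ofReal, max_eq_left h, e]

lemma phiGamE_zero {γ : ℝ} (hγ0 : 0 < γ) (hγ1 : γ ≠ 1) :
    (phiGamE γ 0 : EReal) = (((0 - γ * 0 + γ - 1) / (γ * (γ - 1)) : ℝ) : EReal) := by
  rcases lt_or_gt_of_ne hγ1 with h | h
  · have h' := sub_ne_zero.2 hγ1
    have e : (0 - γ * 0 + γ - 1) / (γ * (γ - 1)) = 1 / γ := by
      field_simp
      ring
    rw [phiGamE, if_neg (lt_irrefl _), if_neg h.not_gt, if_pos ⟨hγ0, rfl⟩,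
      EReal.coe_ennreal_ofReal, max_eq_left (by positivity), e]
  · exact phiGamE_of_nonpos le_rfl h

/-- The `k`-th summand of the scaled Bregman distance, where `e` is the power part of the
generator at `x / p`. -/
lemma bregman_summand {γ p s x e : ℝ} (hγ0 : γ ≠ 0) (hγ1 : γ ≠ 1) (hp : 0 < p) (hs : 0 < s)
    (hx : (phiGamE γ (x / p) : EReal)
      = (((e - γ * (x / p) + γ - 1) / (γ * (γ - 1)) : ℝ) : EReal)) :
    (p : EReal) * ((phiGamE γ (x / p) : EReal) - (phiGamE γ (s / p) : EReal)
        - ((dphiGamR γ (s / p) * (x / p - s / p) : ℝ) : EReal))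
      = (((p * e + (γ - 1) * (s ^ γ * p ^ (1 - γ))
          - γ * (x * s ^ (γ - 1) * p ^ (1 - γ))) / (γ * (γ - 1)) : ℝ) : EReal) := by
  rw [hx, phiGamE_of_pos hγ0 hγ1 (div_pos hs hp), ← EReal.coe_sub, ← EReal.coe_sub,
    ← EReal.coe_mul, EReal.coe_eq_coe_iff, dphiGamR]
  have h1 := sub_ne_zero.2 hγ1
  have hP := (Real.rpow_pos_of_pos hp γ).ne'
  rw [Real.rpow_sub_one (div_pos hs hp).ne', Real.rpow_sub_one hs.ne', Real.rpow_sub hp,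
    Real.rpow_one, Real.div_rpow hs.le hp.le]
  field_simp
  ring

lemma coe_finset_sum {ι : Type*} (s : Finset ι) (f : ι → ℝ) :
    ((∑ i ∈ s, f i : ℝ) : EReal) = ∑ i ∈ s, (f i : EReal) :=
  map_sum (⟨⟨Real.toEReal, EReal.coe_zero⟩, EReal.coe_add⟩ : ℝ →+ EReal) f s

lemma sum_eq_top {ι : Type*} {s : Finset ι} {f : ι → EReal} (hbot : ∀ i ∈ s, f i ≠ ⊥)
    {i : ι} (hi : i ∈ s) (htop : f i = ⊤) : ∑ j ∈ s, f j = ⊤ := by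
  classical
  rw [← Finset.add_sum_erase s f hi, htop]
  refine EReal.top_add_of_ne_bot ?_
  refine Finset.sum_induction f (· ≠ ⊥) (fun a b ha hb => ?_) EReal.zero_ne_bot
    fun j hj => hbot j (Finset.mem_of_mem_erase hj)
  exact EReal.add_ne_bot_iff.2 ⟨ha, hb⟩

section

variable {K : ℕ} {γ c m : ℝ} {p Qs Q : Fin K → ℝ}

lemma DSBDg_eq_of_phiGamE {X e : Fin K → ℝ} (hγ0 : γ ≠ 0) (hγ1 : γ ≠ 1) (hp : ∀ k, 0 < p k)
    (hQs : ∀ k, 0 < Qs k)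
    (hX : ∀ k, (phiGamE γ (X k / p k) : EReal)
      = (((e k - γ * (X k / p k) + γ - 1) / (γ * (γ - 1)) : ℝ) : EReal)) :
    DSBDg K γ c p Qs X = ((c * ((∑ k, p k * e k + (γ - 1) * Hgam K γ Qs p
      - γ * Tgam K γ X Qs p) / (γ * (γ - 1))) : ℝ) : EReal) := by
  rw [DSBDg, Finset.sum_congr rfl fun k _ => bregman_summand hγ0 hγ1 (hp k) (hQs k) (hX k),
    ← coe_finset_sum, ← EReal.coe_mul, ← Finset.sum_div, Finset.sum_sub_distrib,
    Finset.sum_add_distrib, ← Finset.mul_sum, ← Finset.mul_sum, Hgam, Tgam]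

lemma Tgam_smul : Tgam K γ (m • Q) Qs p = m * Tgam K γ Q Qs p := by
  simp only [Tgam, Pi.smul_apply, smul_eq_mul, Finset.mul_sum, mul_assoc]

lemma DSBDg_smul_of_pos (hγ0 : γ ≠ 0) (hγ1 : γ ≠ 1) (hp : ∀ k, 0 < p k)
    (hQs : ∀ k, 0 < Qs k) (hQ : ∀ k, 0 < Q k ∨ 0 < γ ∧ Q k = 0) (hm : 0 < m) :
    DSBDg K γ c p Qs (m • Q) = ((c * ((m ^ γ * Hgam K γ Q p + (γ - 1) * Hgam K γ Qs p
      - γ * (m * Tgam K γ Q Qs p)) / (γ * (γ - 1))) : ℝ) : EReal) := by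
  rw [DSBDg_eq_of_phiGamE (e := fun k => ((m • Q) k / p k) ^ γ) hγ0 hγ1 hp hQs, Tgam_smul]
  · have e : ∑ k, p k * ((m • Q) k / p k) ^ γ = m ^ γ * Hgam K γ Q p := by
      rw [Hgam, Finset.mul_sum]
      refine Finset.sum_congr rfl fun k _ => ?_
      have hk : 0 ≤ Q k := by rcases hQ k with h | h <;> linarith
      have hP := (Real.rpow_pos_of_pos (hp k) γ).ne'
      rw [Pi.smul_apply, smul_eq_mul, Real.div_rpow (mul_nonneg hm.le hk) (hp k).le,
        Real.mul_rpow hm.le hk, Real.rpow_sub (hp k), Real.rpow_one]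
      field_simp
    rw [e]
  · intro k
    rcases hQ k with h | ⟨h0, h⟩
    · exact phiGamE_of_pos hγ0 hγ1 (div_pos (mul_pos hm h) (hp k))
    · simpa [h, Real.zero_rpow hγ0] using phiGamE_zero h0 hγ1

lemma DSBDg_smul_of_neg_of_one_lt (hγ : 1 < γ) (hp : ∀ k, 0 < p k)
    (hQs : ∀ k, 0 < Qs k) (hQ : ∀ k, 0 ≤ Q k) (hm : m < 0) :
    DSBDg K γ c p Qs (m • Q) = ((c * (((γ - 1) * Hgam K γ Qs p
      - γ * (m * Tgam K γ Q Qs p)) / (γ * (γ - 1))) : ℝ) : EReal) := by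
  rw [DSBDg_eq_of_phiGamE (e := fun _ => 0) (by linarith) hγ.ne' hp hQs, Tgam_smul]
  · simp
  · exact fun k => phiGamE_of_nonpos (div_nonpos_of_nonpos_of_nonneg
      (mul_nonpos_of_nonpos_of_nonneg hm.le (hQ k)) (hp k).le) hγ

lemma DSBDg_smul_of_neg_of_lt_one (hc : 0 < c) (hγ0 : γ ≠ 0) (hγ : γ < 1) (hp : ∀ k, 0 < p k)
    (hQs : ∀ k, 0 < Qs k) (hm : m < 0) (hQ : ∃ k, 0 < Q k) :
    DSBDg K γ c p Qs (m • Q) = ⊤ := by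
  obtain ⟨i, hi⟩ := hQ
  have hi' : (m • Q) i / p i < 0 := div_neg_of_neg_of_pos (mul_neg_of_neg_of_pos hm hi) (hp i)
  have htop : phiGamE γ ((m • Q) i / p i) = ⊤ := by
    rw [phiGamE, if_neg hi'.not_gt, if_neg hγ.not_gt, if_neg fun h => hi'.ne h.2]
  rw [DSBDg, sum_eq_top (i := i) _ (Finset.mem_univ i), EReal.coe_mul_top_of_pos hc]
  · rw [htop, phiGamE_of_pos hγ0 hγ.ne (div_pos (hQs i) (hp i)), EReal.coe_ennreal_top,
      EReal.top_sub_coe, EReal.top_sub_coe, EReal.coe_mul_top_of_pos (hp i)]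
  · intro k _
    rw [phiGamE_of_pos hγ0 hγ.ne (div_pos (hQs k) (hp k))]
    cases phiGamE γ ((m • Q) k / p k) with
    | top =>
      rw [EReal.coe_ennreal_top, EReal.top_sub_coe, EReal.top_sub_coe,
        EReal.coe_mul_top_of_pos (hp k)]
      exact top_ne_bot
    | coe a =>
      rw [EReal.coe_nnreal_eq_coe_real, ← EReal.coe_sub, ← EReal.coe_sub, ← EReal.coe_mul]
      exact EReal.coe_ne_bot _

end

/-- Theorem `theorem inner min Bregman power general`(a):
explicit inner `m`-minimization of the scaled Bregman power distances,
`inf_{m≠0} D^{SBD}_{c̃·φ_γ,P}(m·Q,Q**)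
  = (c̃/γ)·[H_γ(Q**,P) − T_γ(Q,Q**,P)^{γ/(γ−1)}·H_γ(Q,P)^{−1/(γ−1)}]`. -/
theorem statement11
    (K : ℕ) (A : ℝ) (hA : 0 < A) (p : Fin K → ℝ) (hp : ∀ k, 0 < p k)
    (c γ : ℝ) (hc : 0 < c) (hγ0 : γ ≠ 0) (hγ1 : γ ≠ 1)
    (Qs : Fin K → ℝ) (hQs : ∀ k, 0 < Qs k) (Q : Fin K → ℝ)
    (hQneg : γ < 0 → Q ∈ A • stdSimplexPos K)
    (hQpos : 0 < γ → Q ∈ A • stdSimplex ℝ (Fin K)) :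
    (⨅ (m : ℝ) (_ : m ≠ 0), DSBDg K γ c p Qs (m • Q))
      = (((c / γ) * (Hgam K γ Qs p
          - Tgam K γ Q Qs p ^ (γ / (γ - 1)) * Hgam K γ Q p ^ (-1 / (γ - 1))) : ℝ) : EReal) := by
  have hQ : (∀ k, 0 < Q k ∨ 0 < γ ∧ Q k = 0) ∧ ∑ k, Q k = A := by
    rcases lt_or_gt_of_ne hγ0 with h | h
    · obtain ⟨R, ⟨hR, hR1⟩, rfl⟩ := hQneg h
      exact ⟨fun k => Or.inl (mul_pos hA (hR k)), by simp [← Finset.mul_sum, hR1]⟩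
    · obtain ⟨R, ⟨hR, hR1⟩, rfl⟩ := hQpos h
      refine ⟨fun k => ?_, by simp [← Finset.mul_sum, hR1]⟩
      rcases (hR k).eq_or_lt with hk | hk
      · exact Or.inr ⟨h, by simp [← hk]⟩
      · exact Or.inl (mul_pos hA hk)
  obtain ⟨hQ, hQA⟩ := hQ
  have hQnn : ∀ k, 0 ≤ Q k := fun k => (hQ k).elim le_of_lt fun h => h.2.ge
  obtain ⟨i, hi⟩ : ∃ k, 0 < Q k := by
    by_contra! h
    linarith [Finset.sum_nonpos fun k (_ : k ∈ Finset.univ) => h k]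
  have hγ := sub_ne_zero.2 hγ1
  have hT : 0 < Tgam K γ Q Qs p :=
    Finset.sum_pos' (fun k _ => mul_nonneg (mul_nonneg (hQnn k) (Real.rpow_pos_of_pos (hQs k) _).le)
      (Real.rpow_pos_of_pos (hp k) _).le) ⟨i, Finset.mem_univ i,
      mul_pos (mul_pos hi (Real.rpow_pos_of_pos (hQs i) _)) (Real.rpow_pos_of_pos (hp i) _)⟩
  have hH : 0 < Hgam K γ Q p :=
    Finset.sum_pos' (fun k _ => mul_nonneg (Real.rpow_nonneg (hQnn k) _)
      (Real.rpow_pos_of_pos (hp k) _).le) ⟨i, Finset.mem_univ i,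
      mul_pos (Real.rpow_pos_of_pos hi _) (Real.rpow_pos_of_pos (hp i) _)⟩
  set T := Tgam K γ Q Qs p with hTdef
  set H := Hgam K γ Q p with hHdef
  set m₀ := (T / H) ^ (1 / (γ - 1)) with hm₀
  have hm₀pos : 0 < m₀ := Real.rpow_pos_of_pos (div_pos hT hH) _
  have hcrit : m₀ ^ (γ - 1) = T / H := by
    rw [hm₀, ← Real.rpow_mul (div_pos hT hH).le, one_div_mul_cancel hγ, Real.rpow_one]
  have hTeq : T = H * m₀ ^ (γ - 1) := by rw [hcrit, mul_div_cancel₀ _ hH.ne']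
  have hval : T ^ (γ / (γ - 1)) * H ^ (-1 / (γ - 1)) = m₀ * T := by
    have e : γ / (γ - 1) = 1 / (γ - 1) + 1 := by
      field_simp
      ring
    rw [hm₀, Real.div_rpow hT.le hH.le, e, Real.rpow_add_one hT.ne', neg_div, Real.rpow_neg hH.le]
    ring
  have hpow : m₀ ^ γ * H = m₀ * T := by
    rw [hTeq, Real.rpow_sub_one hm₀pos.ne']
    field_simp
  rw [hval]
  apply le_antisymm
  · refine (iInf₂_le m₀ hm₀pos.ne').trans_eq ?_
    rw [DSBDg_smul_of_pos hγ0 hγ1 hp hQs hQ hm₀pos, ← hTdef, ← hHdef, hpow,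
      EReal.coe_eq_coe_iff]
    field_simp
    ring
  · refine le_iInf₂ fun m hm => ?_
    rcases lt_or_gt_of_ne hm with hm | hm
    · rcases lt_or_gt_of_ne hγ1 with h1 | h1
      · rw [DSBDg_smul_of_neg_of_lt_one hc hγ0 h1 hp hQs hm ⟨i, hi⟩]
        exact le_top
      · rw [DSBDg_smul_of_neg_of_one_lt h1 hp hQs hQnn hm, ← hTdef, EReal.coe_le_coe_iff,
          div_mul_eq_mul_div, mul_div_assoc]
        refine mul_le_mul_of_nonneg_left ?_ hc.le
        have e : ((γ - 1) * Hgam K γ Qs p - γ * (m * T)) / (γ * (γ - 1))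
            = (Hgam K γ Qs p - m₀ * T) / γ + (m₀ * T / γ + -m * T / (γ - 1)) := by
          field_simp
          ring
        rw [e]
        have := div_nonneg (mul_pos hm₀pos hT).le (by linarith : (0 : ℝ) ≤ γ)
        have := div_nonneg (mul_pos (neg_pos.2 hm) hT).le (by linarith : (0 : ℝ) ≤ γ - 1)
        linarith
    · rw [DSBDg_smul_of_pos hγ0 hγ1 hp hQs hQ hm, ← hTdef, ← hHdef, EReal.coe_le_coe_iff,
        div_mul_eq_mul_div, mul_div_assoc]
      refine mul_le_mul_of_nonneg_left ?_ hc.le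
      have e : (m ^ γ * H + (γ - 1) * Hgam K γ Qs p - γ * (m * T)) / (γ * (γ - 1))
          = (Hgam K γ Qs p - m₀ * T) / γ
            + H * ((m ^ γ - γ * m * m₀ ^ (γ - 1) + (γ - 1) * m₀ ^ γ) / (γ * (γ - 1))) := by
        rw [← hpow, hTeq]
        field_simp
        ring
      rw [e]
      exact le_add_of_nonneg_right (mul_nonneg hH.le (rpow_tangent_nonneg hγ0 hγ1 hm hm₀pos))

end BareSim
end
end

section
/- Let A > 0, P ∈ ℝ^K with all p_k > 0, c̃ > 0, Q** ∈ ℝ^K with all q**_k > 0, and Q ∈ A·𝕊^K. Then inf_{m≠0} D^{SBD}_{c̃·φ_1,P}(m·Q, Q**) = c̃·[ M_{Q**} − A·exp( −I(Q,Q**)/A ) ]; in particular this value does not depend on P. -/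
open scoped BigOperators ENNReal Pointwise

noncomputable section

namespace BareSim

/-- The Kullback–Leibler generator `φ_1 : ℝ → [0,∞]`:
`φ_1(t) = t·log t + 1 − t` for `t ≥ 0` (with `0·log 0 := 0`), `+∞` for `t < 0`. -/
def phiOneE (t : ℝ) : ℝ≥0∞ :=
  if 0 ≤ t then ENNReal.ofReal (t * Real.log t + 1 - t) else ⊤

/-- The scaled Bregman distance `D^{SBD}_{c̃·φ_1,P}(Q,Q**)` with generator `c̃·φ_1`
and scaling vector `P` (derivative `φ_1'(t) = log t`). -/
def DSBDone (K : ℕ) (c : ℝ) (p Qs Q : Fin K → ℝ) : EReal :=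
  ((c : ℝ) : EReal) * ∑ k, ((p k : ℝ) : EReal) *
    ((phiOneE (Q k / p k) : EReal) - (phiOneE (Qs k / p k) : EReal)
      - ((Real.log (Qs k / p k) * (Q k / p k - Qs k / p k) : ℝ) : EReal))

theorem mul_log_add_one_sub_nonneg {t : ℝ} (ht : 0 ≤ t) : 0 ≤ t * Real.log t + 1 - t := by
  rcases ht.eq_or_lt with rfl | ht
  · simp
  · have h := mul_le_mul_of_nonneg_left (Real.one_sub_inv_le_log_of_pos ht) ht.le
    rw [mul_sub, mul_inv_cancel₀ ht.ne'] at h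
    linarith

theorem coe_phiOneE_of_nonneg {t : ℝ} (ht : 0 ≤ t) :
    (phiOneE t : EReal) = ((t * Real.log t + 1 - t : ℝ) : EReal) := by
  rw [phiOneE, if_pos ht, EReal.coe_ennreal_ofReal, max_eq_left (mul_log_add_one_sub_nonneg ht)]

theorem phiOneE_of_neg {t : ℝ} (ht : t < 0) : phiOneE t = ⊤ := if_neg ht.not_ge

/-- A single summand of `DSBDone` at a nonnegative coordinate does not depend on the scaling. -/
theorem DSBDone_term_of_nonneg {p s q : ℝ} (hp : 0 < p) (hs : 0 < s) (hq : 0 ≤ q) :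
    (p : EReal) * ((phiOneE (q / p) : EReal) - (phiOneE (s / p) : EReal)
      - ((Real.log (s / p) * (q / p - s / p) : ℝ) : EReal))
      = ((q * Real.log (q / s) + s - q : ℝ) : EReal) := by
  rw [coe_phiOneE_of_nonneg (div_nonneg hq hp.le), coe_phiOneE_of_nonneg (div_pos hs hp).le]
  norm_cast
  rcases hq.eq_or_lt with rfl | hq
  · field_simp
    simp only [zero_div, zero_mul, zero_add, sub_zero, zero_sub]
    ring
  · rw [Real.log_div hq.ne' hp.ne', Real.log_div hs.ne' hp.ne', Real.log_div hq.ne' hs.ne']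
    field_simp
    ring

/-- A single summand of `DSBDone` at a negative coordinate is infinite. -/
theorem DSBDone_term_of_neg {p s q : ℝ} (hp : 0 < p) (hs : 0 < s) (hq : q < 0) :
    (p : EReal) * ((phiOneE (q / p) : EReal) - (phiOneE (s / p) : EReal)
      - ((Real.log (s / p) * (q / p - s / p) : ℝ) : EReal)) = ⊤ := by
  rw [phiOneE_of_neg (div_neg_of_neg_of_pos hq hp), coe_phiOneE_of_nonneg (div_pos hs hp).le,
    EReal.coe_ennreal_top, EReal.top_sub_coe, EReal.top_sub_coe, EReal.coe_mul_top_of_pos hp]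

theorem mul_log_div_add_sub_nonneg {s q : ℝ} (hs : 0 < s) (hq : 0 ≤ q) :
    0 ≤ q * Real.log (q / s) + s - q := by
  have h := mul_nonneg hs.le (mul_log_add_one_sub_nonneg (div_nonneg hq hs.le))
  have e : s * (q / s * Real.log (q / s) + 1 - q / s) = q * Real.log (q / s) + s - q := by
    field_simp
  rwa [e] at h

theorem DSBDone_of_nonneg {K : ℕ} {c : ℝ} {p Qs Q : Fin K → ℝ} (hp : ∀ k, 0 < p k)
    (hQs : ∀ k, 0 < Qs k) (hQ : ∀ k, 0 ≤ Q k) :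
    DSBDone K c p Qs Q
      = ((c * ∑ k, (Q k * Real.log (Q k / Qs k) + Qs k - Q k) : ℝ) : EReal) := by
  rw [DSBDone, Finset.sum_congr rfl fun k _ => DSBDone_term_of_nonneg (hp k) (hQs k) (hQ k),
    EReal.coe_mul]
  congr 1
  exact (map_sum (⟨⟨Real.toEReal, EReal.coe_zero⟩, EReal.coe_add⟩ : ℝ →+ EReal) _ _).symm

theorem DSBDone_of_neg {K : ℕ} {c : ℝ} (hc : 0 < c) {p Qs Q : Fin K → ℝ} (hp : ∀ k, 0 < p k)
    (hQs : ∀ k, 0 < Qs k) {j : Fin K} (hj : Q j < 0) : DSBDone K c p Qs Q = ⊤ := by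
  have hsum : (⊤ : EReal) ≤ ∑ k, ((p k : ℝ) : EReal) *
      ((phiOneE (Q k / p k) : EReal) - (phiOneE (Qs k / p k) : EReal)
        - ((Real.log (Qs k / p k) * (Q k / p k - Qs k / p k) : ℝ) : EReal)) := by
    rw [← DSBDone_term_of_neg (hp j) (hQs j) hj]
    refine Finset.single_le_sum (f := fun k => ((p k : ℝ) : EReal) *
      ((phiOneE (Q k / p k) : EReal) - (phiOneE (Qs k / p k) : EReal)
        - ((Real.log (Qs k / p k) * (Q k / p k - Qs k / p k) : ℝ) : EReal)))
      (fun k _ => ?_) (Finset.mem_univ j)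
    rcases lt_or_ge (Q k) 0 with hk | hk
    · simp only [DSBDone_term_of_neg (hp k) (hQs k) hk, le_top]
    · simp only [DSBDone_term_of_nonneg (hp k) (hQs k) hk]
      exact_mod_cast mul_log_div_add_sub_nonneg (hQs k) hk
  rw [DSBDone, top_le_iff.mp hsum, EReal.coe_mul_top_of_pos hc]

theorem sum_smul_mul_log_div {K : ℕ} {Qs Q : Fin K → ℝ} (hQs : ∀ k, 0 < Qs k) {m : ℝ}
    (hm : 0 < m) :
    ∑ k, ((m • Q) k * Real.log ((m • Q) k / Qs k) + Qs k - (m • Q) k)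
      = m * (∑ k, Q k * Real.log (Q k / Qs k)) + m * Real.log m * (∑ k, Q k)
        + (∑ k, Qs k) - m * ∑ k, Q k := by
  simp only [Finset.mul_sum, ← Finset.sum_add_distrib, ← Finset.sum_sub_distrib]
  refine Finset.sum_congr rfl fun k _ => ?_
  rw [Pi.smul_apply, smul_eq_mul]
  by_cases hk : Q k = 0
  · simp [hk]
  · rw [mul_div_assoc, Real.log_mul hm.ne' (div_ne_zero hk (hQs k).ne')]
    ring

theorem iInf_DSBDone_smul {K : ℕ} {A : ℝ} (hA : 0 < A) {p : Fin K → ℝ} (hp : ∀ k, 0 < p k)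
    {c : ℝ} (hc : 0 < c) {Qs : Fin K → ℝ} (hQs : ∀ k, 0 < Qs k)
    {Q : Fin K → ℝ} (hQ : Q ∈ A • stdSimplex ℝ (Fin K)) :
    (⨅ (m : ℝ) (_ : m ≠ 0), DSBDone K c p Qs (m • Q))
      = ((c * ((∑ k, Qs k)
          - A * Real.exp (-(∑ k, Q k * Real.log (Q k / Qs k)) / A)) : ℝ) : EReal) := by
  obtain ⟨R, ⟨hR, hR1⟩, rfl⟩ := hQ
  have hnn : ∀ k, 0 ≤ (A • R) k := fun k => mul_nonneg hA.le (hR k)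
  have hsum : ∑ k, (A • R) k = A := by
    simp only [Pi.smul_apply, smul_eq_mul, ← Finset.mul_sum, hR1, mul_one]
  change (⨅ (m : ℝ) (_ : m ≠ 0), DSBDone K c p Qs (m • A • R))
    = ((c * ((∑ k, Qs k) - A * Real.exp
      (-(∑ k, (A • R) k * Real.log ((A • R) k / Qs k)) / A)) : ℝ) : EReal)
  generalize A • R = Q at hnn hsum
  have hpos : ∀ m : ℝ, 0 < m → DSBDone K c p Qs (m • Q)
      = ((c * (m * (∑ k, Q k * Real.log (Q k / Qs k)) + m * Real.log m * A
        + (∑ k, Qs k) - m * A) : ℝ) : EReal) := fun m hm => by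
    rw [DSBDone_of_nonneg (Q := m • Q) hp hQs fun k => mul_nonneg hm.le (hnn k),
      sum_smul_mul_log_div hQs hm, hsum]
  generalize ∑ k, Q k * Real.log (Q k / Qs k) = I at hpos ⊢
  refine le_antisymm ?_ (le_iInf₂ fun m hm => ?_)
  · refine (iInf₂_le (Real.exp (-I / A)) (Real.exp_pos _).ne').trans (le_of_eq ?_)
    rw [hpos _ (Real.exp_pos _), Real.log_exp]
    congr 2
    field_simp
    ring
  · rcases hm.lt_or_gt with hm | hm
    · obtain ⟨j, -, hj⟩ : ∃ j ∈ Finset.univ, 0 < Q j :=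
        Finset.exists_lt_of_sum_lt (by simpa [hsum] using hA)
      rw [DSBDone_of_neg hc hp hQs (j := j) (mul_neg_of_neg_of_pos hm hj)]
      exact le_top
    · rw [hpos m hm, EReal.coe_le_coe_iff]
      refine mul_le_mul_of_nonneg_left ?_ hc.le
      have h := mul_nonneg hA.le (mul_log_div_add_sub_nonneg (Real.exp_pos (-I / A)) hm.le)
      rw [Real.log_div hm.ne' (Real.exp_pos _).ne', Real.log_exp] at h
      have e : A * (m * (Real.log m - -I / A) + Real.exp (-I / A) - m)
          = m * I + m * Real.log m * A - m * A + A * Real.exp (-I / A) := by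
        field_simp
        ring
      linarith

/-- Theorem `theorem inner min Bregman power general`(b), case `γ = 1`:
`inf_{m≠0} D^{SBD}_{c̃·φ_1,P}(m·Q,Q**) = c̃·[M_{Q**} − A·exp(−I(Q,Q**)/A)]`;
in particular this value does not depend on `P`. -/
theorem statement12
    (K : ℕ) (A : ℝ) (hA : 0 < A) (p : Fin K → ℝ) (hp : ∀ k, 0 < p k)
    (c : ℝ) (hc : 0 < c)
    (Qs : Fin K → ℝ) (hQs : ∀ k, 0 < Qs k)
    (Q : Fin K → ℝ) (hQ : Q ∈ A • stdSimplex ℝ (Fin K)) :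
    (⨅ (m : ℝ) (_ : m ≠ 0), DSBDone K c p Qs (m • Q))
        = ((c * ((∑ k, Qs k)
            - A * Real.exp (-(∑ k, Q k * Real.log (Q k / Qs k)) / A)) : ℝ) : EReal) ∧
      ∀ p' : Fin K → ℝ, (∀ k, 0 < p' k) →
        (⨅ (m : ℝ) (_ : m ≠ 0), DSBDone K c p' Qs (m • Q))
          = (⨅ (m : ℝ) (_ : m ≠ 0), DSBDone K c p Qs (m • Q)) :=
  ⟨iInf_DSBDone_smul hA hp hc hQs hQ, fun _ hp' =>
    (iInf_DSBDone_smul hA hp' hc hQs hQ).trans (iInf_DSBDone_smul hA hp hc hQs hQ).symm⟩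

end BareSim
end
end

section
/- Let A > 0, P ∈ ℝ^K with all p_k > 0, c̃ > 0, Q** ∈ ℝ^K with all q**_k > 0, and Q ∈ A·𝕊^K_{>0}. Then inf_{m≠0} D^{SBD}_{c̃·φ_0,P}(m·Q, Q**) = c̃·[ M_P·log T_0(Q,Q**,P) + T̆_0(Q,Q**,P) − M_P·log M_P ]. -/
open scoped BigOperators ENNReal Pointwise

noncomputable section

namespace BareSim

/-- The reverse Kullback–Leibler generator `φ_0 : ℝ → [0,∞]`:
`φ_0(t) = −log t + t − 1` for `t > 0`, `+∞` for `t ≤ 0`. -/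
def phiZeroE (t : ℝ) : ℝ≥0∞ :=
  if 0 < t then ENNReal.ofReal (-Real.log t + t - 1) else ⊤

/-- The scaled Bregman distance `D^{SBD}_{c̃·φ_0,P}(Q,Q**)` with generator `c̃·φ_0`
and scaling vector `P` (derivative `φ_0'(t) = 1 − 1/t`). -/
def DSBDzero (K : ℕ) (c : ℝ) (p Qs Q : Fin K → ℝ) : EReal :=
  ((c : ℝ) : EReal) * ∑ k, ((p k : ℝ) : EReal) *
    ((phiZeroE (Q k / p k) : EReal) - (phiZeroE (Qs k / p k) : EReal)
      - (((1 - 1 / (Qs k / p k)) * (Q k / p k - Qs k / p k) : ℝ) : EReal))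

lemma coe_phiZeroE_of_pos {t : ℝ} (ht : 0 < t) :
    (phiZeroE t : EReal) = ((-Real.log t + t - 1 : ℝ) : EReal) := by
  have h := Real.log_le_sub_one_of_pos ht
  rw [phiZeroE, if_pos ht, EReal.coe_ennreal_ofReal, max_eq_left (by linarith)]

lemma DSBDzero_of_pos {K : ℕ} (c : ℝ) {p Qs Q : Fin K → ℝ} (hp : ∀ k, 0 < p k)
    (hQs : ∀ k, 0 < Qs k) (hQ : ∀ k, 0 < Q k) :
    DSBDzero K c p Qs Q
      = ((c * ∑ k, p k * (-Real.log (Q k / Qs k) + Q k / Qs k - 1) : ℝ) : EReal) := by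
  rw [DSBDzero, EReal.coe_mul, coe_finset_sum]
  congr 1
  refine Finset.sum_congr rfl fun k _ => ?_
  have h1 := hp k
  have h2 := hQs k
  have h3 := hQ k
  rw [coe_phiZeroE_of_pos (div_pos h3 h1), coe_phiZeroE_of_pos (div_pos h2 h1),
    ← EReal.coe_sub, ← EReal.coe_sub, ← EReal.coe_mul, Real.log_div h3.ne' h1.ne',
    Real.log_div h2.ne' h1.ne', Real.log_div h3.ne' h2.ne']
  congr 1
  field_simp
  ring

lemma DSBDzero_of_neg {K : ℕ} (hK : K ≠ 0) {c : ℝ} (hc : 0 < c) {p Qs Q : Fin K → ℝ}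
    (hp : ∀ k, 0 < p k) (hQs : ∀ k, 0 < Qs k) (hQ : ∀ k, Q k < 0) :
    DSBDzero K c p Qs Q = ⊤ := by
  have h : ∀ k ∈ Finset.univ, ((p k : ℝ) : EReal) *
      ((phiZeroE (Q k / p k) : EReal) - (phiZeroE (Qs k / p k) : EReal)
        - (((1 - 1 / (Qs k / p k)) * (Q k / p k - Qs k / p k) : ℝ) : EReal)) = ⊤ := by
    intro k _
    rw [coe_phiZeroE_of_pos (div_pos (hQs k) (hp k)), phiZeroE,
      if_neg (div_neg_of_neg_of_pos (hQ k) (hp k)).not_gt, EReal.coe_ennreal_top,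
      EReal.top_sub_coe, EReal.top_sub_coe, EReal.coe_mul_top_of_pos (hp k)]
  rw [DSBDzero, Finset.sum_congr rfl h, Finset.sum_const, Finset.card_univ, Fintype.card_fin,
    EReal.nsmul_eq_mul, EReal.mul_top_of_pos (by exact_mod_cast Nat.pos_of_ne_zero hK),
    EReal.coe_mul_top_of_pos hc]

lemma sum_mul_neg_log_smul {K : ℕ} {p Qs Q : Fin K → ℝ} (hQs : ∀ k, 0 < Qs k)
    (hQ : ∀ k, 0 < Q k) {m : ℝ} (hm : 0 < m) :
    ∑ k, p k * (-Real.log ((m • Q) k / Qs k) + (m • Q) k / Qs k - 1)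
      = m * (∑ k, Q k * (Qs k)⁻¹ * p k) - (∑ k, p k) * Real.log m - ∑ k, p k
        + (-∑ k, p k * Real.log (Q k / Qs k)) := by
  rw [Finset.mul_sum, Finset.sum_mul, ← Finset.sum_neg_distrib, ← Finset.sum_sub_distrib,
    ← Finset.sum_sub_distrib, ← Finset.sum_add_distrib]
  refine Finset.sum_congr rfl fun k _ => ?_
  rw [Pi.smul_apply, smul_eq_mul, mul_div_assoc,
    Real.log_mul hm.ne' (div_pos (hQ k) (hQs k)).ne']
  ring

lemma DSBDzero_smul_of_pos {K : ℕ} (c : ℝ) {p Qs Q : Fin K → ℝ} (hp : ∀ k, 0 < p k)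
    (hQs : ∀ k, 0 < Qs k) (hQ : ∀ k, 0 < Q k) {m : ℝ} (hm : 0 < m) :
    DSBDzero K c p Qs (m • Q)
      = ((c * (m * (∑ k, Q k * (Qs k)⁻¹ * p k) - (∑ k, p k) * Real.log m - ∑ k, p k
        + (-∑ k, p k * Real.log (Q k / Qs k))) : ℝ) : EReal) := by
  rw [← sum_mul_neg_log_smul hQs hQ hm]
  exact DSBDzero_of_pos c hp hQs fun k => mul_pos hm (hQ k)

/-- `m ↦ m T - M log m - M` is minimized over `m > 0` at `m = M / T`, where its value is
`M log T - M log M`. -/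
lemma mul_log_sub_le {M T m : ℝ} (hM : 0 < M) (hT : 0 < T) (hm : 0 < m) :
    M * Real.log T - M * Real.log M ≤ m * T - M * Real.log m - M := by
  have h := mul_le_mul_of_nonneg_left
    (Real.log_le_sub_one_of_pos (div_pos (mul_pos hm hT) hM)) hM.le
  rw [Real.log_div (mul_pos hm hT).ne' hM.ne', Real.log_mul hm.ne' hT.ne', mul_sub M (_ / _),
    mul_div_cancel₀ _ hM.ne'] at h
  linarith

/-- Theorem `theorem inner min Bregman power general`(c), case `γ = 0`:
`inf_{m≠0} D^{SBD}_{c̃·φ_0,P}(m·Q,Q**)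
  = c̃·[M_P·log T_0(Q,Q**,P) + T̆_0(Q,Q**,P) − M_P·log M_P]`. -/
theorem statement13
    (K : ℕ) (A : ℝ) (hA : 0 < A) (p : Fin K → ℝ) (hp : ∀ k, 0 < p k)
    (c : ℝ) (hc : 0 < c)
    (Qs : Fin K → ℝ) (hQs : ∀ k, 0 < Qs k)
    (Q : Fin K → ℝ) (hQ : Q ∈ A • stdSimplexPos K) :
    (⨅ (m : ℝ) (_ : m ≠ 0), DSBDzero K c p Qs (m • Q))
      = ((c * ((∑ k, p k) * Real.log (∑ k, Q k * (Qs k)⁻¹ * p k)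
          + (-∑ k, p k * Real.log (Q k / Qs k))
          - (∑ k, p k) * Real.log (∑ k, p k)) : ℝ) : EReal) := by
  obtain ⟨R, ⟨hR, hR1⟩, hQR⟩ := hQ
  have hQ : ∀ k, 0 < Q k := fun k => hQR ▸ mul_pos hA (hR k)
  have hK : K ≠ 0 := by
    rintro rfl
    simp at hR1
  have : Nonempty (Fin K) := Fin.pos_iff_nonempty.mp (Nat.pos_of_ne_zero hK)
  have hM : 0 < ∑ k, p k := Finset.sum_pos (fun k _ => hp k) Finset.univ_nonempty
  have hT : 0 < ∑ k, Q k * (Qs k)⁻¹ * p k :=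
    Finset.sum_pos (fun k _ => mul_pos (mul_pos (hQ k) (inv_pos.mpr (hQs k))) (hp k))
      Finset.univ_nonempty
  apply le_antisymm
  · have hm := div_pos hM hT
    refine iInf₂_le_of_le _ hm.ne' ?_
    rw [DSBDzero_smul_of_pos c hp hQs hQ hm, EReal.coe_le_coe_iff, Real.log_div hM.ne' hT.ne',
      div_mul_cancel₀ _ hT.ne']
    refine le_of_eq ?_
    ring
  · refine le_iInf₂ fun m hm => ?_
    rcases hm.lt_or_gt with hm | hm
    · exact le_top.trans_eq
        (DSBDzero_of_neg hK hc hp hQs fun k => mul_neg_of_neg_of_pos hm (hQ k)).symm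
    · rw [DSBDzero_smul_of_pos c hp hQs hQ hm, EReal.coe_le_coe_iff]
      refine mul_le_mul_of_nonneg_left ?_ hc.le
      linarith [mul_log_sub_le hM hT hm]

end BareSim
end
end
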